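/- Let T = {1,2,3,4} and set p¹ = (1,1,1,0), q¹ = (0,0,0,1); p² = (1,1,0,1), q² = (0,0,1,0); p³ = (1,0,1,1), q³ = (0,1,0,0); p⁴ = (0,1,1,1), q⁴ = (1,0,0,0). For a PMP M on T let C_i(M) := Π_{(st,σ) ∈ M} [p^i,q^i]_{st,σ}. Then for every PMP M on T, C₁(M) + C₂(M) − C₃(M) − C₄(M) equals 2 if M = {(12,odd),(34,even)}, equals −2 if M = {(12,even),(34,odd)}, and equals 0 otherwise. Consequently M ∈ 𝓜_{2,odd} := {{(12,odd),(34,even)}, {(12,even),(34,odd)}} if and only if C₁(M) + C₂(M) − C₃(M) − C₄(M) ≢ 0 (mod 4), so 𝓜_{2,odd} is h-representable with N = 4, k = 2 and coefficients (1,1,−1,−1) (equivalently (1,1,3,3) modulo 4). -/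

import Mathlib

/-- A parity: `odd` or `even`. -/
inductive Par : Type
  | odd : Par
  | even : Par
deriving DecidableEq

/-- The bracket `[p,q]_{st,σ}`: for a parity `σ` and an unordered pair `{s,t}`,
`[p,q]_{st,odd} = p_s p_t + q_s q_t` and `[p,q]_{st,even} = p_s q_t + q_s p_t`. -/
def brkt {n : ℕ} (p q : Fin n → ℤ) (σ : Par) : Sym2 (Fin n) → ℤ :=
  Sym2.lift ⟨fun s t =>
    match σ with
    | Par.odd => p s * p t + q s * q t
    | Par.even => p s * q t + q s * p t,
    by intro a b; cases σ <;> dsimp only <;> ring⟩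

/-- A perfect matching with parity (PMP) on `{0, …, n−1}`: a set of pairs
`(st, σ)` where the unordered pairs `st` are non-degenerate and partition the
index set, and `σ` is a parity. -/
def IsPMP {n : ℕ} (M : Finset (Sym2 (Fin n) × Par)) : Prop :=
  (∀ x ∈ M, ¬ x.1.IsDiag) ∧ ∀ i : Fin n, ∃! x, x ∈ M ∧ i ∈ x.1

/-- The product `Π_{(st,σ) ∈ M} [p,q]_{st,σ}`. -/
def pmpProd {n : ℕ} (p q : Fin n → ℤ) (M : Finset (Sym2 (Fin n) × Par)) : ℤ :=
  ∏ x ∈ M, brkt p q x.2 x.1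

/-- Two members of a PMP that share an endpoint coincide. -/
theorem IsPMP.eq_of_mem {n : ℕ} {M : Finset (Sym2 (Fin n) × Par)} (hM : IsPMP M)
    {x y : Sym2 (Fin n) × Par} (hx : x ∈ M) (hy : y ∈ M) {i : Fin n} (hix : i ∈ x.1)
    (hiy : i ∈ y.1) : x = y :=
  (hM.2 i).unique ⟨hx, hix⟩ ⟨hy, hiy⟩

/-- Every index of a PMP is matched to a different index, with some parity. -/
theorem IsPMP.exists_partner {n : ℕ} {M : Finset (Sym2 (Fin n) × Par)} (hM : IsPMP M)
    (i : Fin n) : ∃ j σ, i ≠ j ∧ (s(i, j), σ) ∈ M := by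
  obtain ⟨⟨e, σ⟩, ⟨he, hi⟩, -⟩ := hM.2 i
  obtain ⟨j, rfl⟩ := Sym2.mem_iff_exists.1 hi
  exact ⟨j, σ, fun h => hM.1 _ he (Sym2.mk_isDiag_iff.2 h), he⟩

/-- A PMP is determined by any of its subsets that covers all indices. -/
theorem IsPMP.eq_of_subset {n : ℕ} {M N : Finset (Sym2 (Fin n) × Par)} (hM : IsPMP M)
    (hNM : N ⊆ M) (hN : ∀ i, ∃ y ∈ N, i ∈ y.1) : M = N := by
  refine Finset.Subset.antisymm (fun x hx => ?_) hNM
  obtain ⟨i, hi⟩ : ∃ i, i ∈ x.1 := ⟨_, Sym2.out_fst_mem x.1⟩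
  obtain ⟨y, hy, hiy⟩ := hN i
  exact hM.eq_of_mem hx (hNM hy) hi hiy ▸ hy

/-- If `i` is matched to `j` in a PMP on four points, the remaining points `k` and `l` are matched
to each other. -/
theorem IsPMP.eq_pair {M : Finset (Sym2 (Fin 4) × Par)} (hM : IsPMP M) {i j k l : Fin 4}
    (h : ∀ m, m = i ∨ m = j ∨ m = k ∨ m = l) (hki : k ≠ i) (hkj : k ≠ j) {σ : Par}
    (hσ : (s(i, j), σ) ∈ M) : ∃ τ, M = {(s(i, j), σ), (s(k, l), τ)} := by
  obtain ⟨m, τ, hkm, hτ⟩ := hM.exists_partner k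
  have hm : m ∉ s(i, j) := fun hm => by
    have he : s(k, m) = s(i, j) :=
      congrArg Prod.fst (hM.eq_of_mem hτ hσ (Sym2.mem_mk_right k m) hm)
    exact (Sym2.mem_iff.1 (he ▸ Sym2.mem_mk_left k m)).elim hki hkj
  rw [Sym2.mem_iff, not_or] at hm
  obtain rfl : m = l := by
    rcases h m with h | h | h | h
    exacts [absurd h hm.1, absurd h hm.2, absurd h.symm hkm, h]
  refine ⟨τ, hM.eq_of_subset (by simp [Finset.insert_subset_iff, hσ, hτ]) fun a => ?_⟩
  rcases h a with rfl | rfl | rfl | rfl <;> simp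

/-- The PMPs on four points come from the three perfect matchings. -/
theorem IsPMP.eq_or_eq_or_eq {M : Finset (Sym2 (Fin 4) × Par)} (hM : IsPMP M) :
    ∃ σ τ, M = {(s(0, 1), σ), (s(2, 3), τ)} ∨ M = {(s(0, 2), σ), (s(1, 3), τ)} ∨
      M = {(s(0, 3), σ), (s(1, 2), τ)} := by
  obtain ⟨j, σ, hj, hσ⟩ := hM.exists_partner 0
  fin_cases j
  · exact absurd rfl hj
  · obtain ⟨τ, h⟩ := hM.eq_pair (k := 2) (l := 3) (by decide) (by decide) (by decide) hσ
    exact ⟨σ, τ, .inl h⟩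
  · obtain ⟨τ, h⟩ := hM.eq_pair (k := 1) (l := 3) (by decide) (by decide) (by decide) hσ
    exact ⟨σ, τ, .inr (.inl h)⟩
  · obtain ⟨τ, h⟩ := hM.eq_pair (k := 1) (l := 2) (by decide) (by decide) (by decide) hσ
    exact ⟨σ, τ, .inr (.inr h)⟩

/-- For `T = {1,2,3,4}` (encoded as `Fin 4`) and the four pairs
of vectors `p¹ = (1,1,1,0), q¹ = (0,0,0,1)`; `p² = (1,1,0,1), q² = (0,0,1,0)`;
`p³ = (1,0,1,1), q³ = (0,1,0,0)`; `p⁴ = (0,1,1,1), q⁴ = (1,0,0,0)`, with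
`C_i(M) = Π_{(st,σ) ∈ M} [p^i,q^i]_{st,σ}`: for every PMP `M` on `T`,
`C₁(M) + C₂(M) − C₃(M) − C₄(M)` equals `2` if `M = {(12,odd),(34,even)}`, equals
`−2` if `M = {(12,even),(34,odd)}`, and `0` otherwise.  Consequently
`M ∈ 𝓜_{2,odd}` iff this combination is `≢ 0 (mod 4)`, so `𝓜_{2,odd}` is
h-representable with `N = 4`, `k = 2` and coefficients `(1,1,−1,−1)`. -/
theorem pmpProd_two_odd_paths (M : Finset (Sym2 (Fin 4) × Par)) (hM : IsPMP M) :
    (pmpProd ![1, 1, 1, 0] ![0, 0, 0, 1] M + pmpProd ![1, 1, 0, 1] ![0, 0, 1, 0] M -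
        pmpProd ![1, 0, 1, 1] ![0, 1, 0, 0] M - pmpProd ![0, 1, 1, 1] ![1, 0, 0, 0] M =
      if M = {(s(0, 1), Par.odd), (s(2, 3), Par.even)} then 2
      else if M = {(s(0, 1), Par.even), (s(2, 3), Par.odd)} then -2
      else 0) ∧
    (M = {(s(0, 1), Par.odd), (s(2, 3), Par.even)} ∨
        M = {(s(0, 1), Par.even), (s(2, 3), Par.odd)} ↔
      ¬ (4 : ℤ) ∣ (pmpProd ![1, 1, 1, 0] ![0, 0, 0, 1] M +
          pmpProd ![1, 1, 0, 1] ![0, 0, 1, 0] M -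
          pmpProd ![1, 0, 1, 1] ![0, 1, 0, 0] M -
          pmpProd ![0, 1, 1, 1] ![1, 0, 0, 0] M)) := by
  obtain ⟨σ, τ, rfl | rfl | rfl⟩ := hM.eq_or_eq_or_eq <;> cases σ <;> cases τ <;> decide
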